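/- Let I be a set of prime numbers and n a positive integer that is a product of primes in I. Let 0 → A →f B →g C → 0 be a short exact sequence of abelian groups (f injective, g surjective, Im f = ker g) in which A is uniquely I-divisible and C is n-torsion. Then the sequence is split: there exists a homomorphism s : C → B with g ∘ s = id_C. -/

import Mathlib

open scoped Classical

/-- A positive natural number `n` is a product of primes belonging to `I`. -/
def IsProductOfPrimesIn (I : Set ℕ) (n : ℕ) : Prop :=
  0 < n ∧ ∀ p : ℕ, p.Prime → p ∣ n → p ∈ I

/-- A short exact sequence `0 → A → B → C → 0` with `A` uniquely `I`-divisible and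
`C` `n`-torsion for some product `n` of primes in `I` is split. -/
theorem splitting_of_uniquelyDivisible_torsion (I : Set ℕ) (hI : ∀ p ∈ I, Nat.Prime p)
    (n : ℕ) (hn : IsProductOfPrimesIn I n)
    (A B C : Type) [AddCommGroup A] [AddCommGroup B] [AddCommGroup C]
    (f : A →+ B) (g : B →+ C) (hf : Function.Injective f) (hg : Function.Surjective g)
    (hfg : Function.Exact f g)
    (hA : ∀ m : ℕ, IsProductOfPrimesIn I m → Function.Bijective (fun a : A => m • a))
    (hC : ∀ c : C, n • c = 0) :
    ∃ s : C →+ B, g.comp s = AddMonoidHom.id C := by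
  obtain ⟨hinj, hsurj⟩ := hA n hn
  -- Every element of `C` has a unique lift to `B` killed by `n`.
  have lift_exists : ∀ c : C, ∃ b : B, n • b = 0 ∧ g b = c := by
    intro c
    obtain ⟨b, rfl⟩ := hg c
    obtain ⟨a, ha⟩ := (hfg (n • b)).1 (by rw [map_nsmul, hC])
    obtain ⟨a', rfl⟩ := hsurj a
    refine ⟨b - f a', ?_, ?_⟩
    · rw [nsmul_sub, ← ha, map_nsmul, sub_self]
    · rw [map_sub, hfg.apply_apply_eq_zero, sub_zero]
  have eq_zero : ∀ b : B, n • b = 0 → g b = 0 → b = 0 := by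
    intro b hb hgb
    obtain ⟨a, rfl⟩ := (hfg b).1 hgb
    rw [← map_nsmul, map_eq_zero_iff f hf] at hb
    have ha : a = 0 := hinj (by simpa using hb)
    rw [ha, map_zero]
  choose s hs hgs using lift_exists
  refine ⟨AddMonoidHom.mk' s fun c d => ?_, AddMonoidHom.ext hgs⟩
  refine sub_eq_zero.1 (eq_zero _ ?_ ?_)
  · rw [nsmul_sub, nsmul_add, hs, hs, hs, add_zero, sub_zero]
  · rw [map_sub, map_add, hgs, hgs, hgs, sub_self]
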